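/- arXiv:2604.24172 — 5 statements merged into one kernel-verified Lean document; each statement's English description precedes it below -/
import Mathlib

section
/- Let K ≥ 1 and let g, h ∈ ℝ^K. Suppose that for every shift vector S ∈ ℝ^K, the set of minimizers argmin_{1 ≤ k ≤ K} (g_k + S_k) equals the set of minimizers argmin_{1 ≤ k ≤ K} (h_k + S_k). Then there exists a constant C ∈ ℝ such that g_k = h_k + C for all k = 1, …, K. -/
/-- If for every shift vector `S` the argmin set of `g + S` equals the
argmin set of `h + S`, then `g` and `h` differ by a constant. -/
theorem argmin_agreement_implies_constant_difference
    (K : ℕ) (hK : 1 ≤ K) (g h : Fin K → ℝ)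
    (hargmin : ∀ S : Fin K → ℝ,
      {k : Fin K | ∀ j : Fin K, g k + S k ≤ g j + S j} =
      {k : Fin K | ∀ j : Fin K, h k + S k ≤ h j + S j}) :
    ∃ C : ℝ, ∀ k : Fin K, g k = h k + C := by
  have key : ∀ k j : Fin K, h k + -g k ≤ h j + -g j := by
    intro k
    have hk : k ∈ {k : Fin K | ∀ j : Fin K, g k + -g k ≤ g j + -g j} := by
      intro j
      simp
    rw [hargmin (fun i => -g i)] at hk
    exact hk
  refine ⟨g ⟨0, hK⟩ - h ⟨0, hK⟩, fun k => ?_⟩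
  have h1 := key k ⟨0, hK⟩
  have h2 := key ⟨0, hK⟩ k
  linarith
end

section
/- Let K ≥ 3, let c > 0, and let f : (0, ∞) → ℝ be a convex, real-analytic function with f(1) = 0. Suppose that for every op ∈ ℝ^K and every score vector S ∈ ℝ^K, writing w^op_k = exp(−op_k)/∑_{j=1}^K exp(−op_j), the set of minimizers argmin_{1 ≤ k ≤ K} (c·f(w^op_k) + S_k) equals the set of minimizers argmin_{1 ≤ k ≤ K} (op_k + S_k). Then c·f(x) = −log x for all x ∈ (0, ∞); in particular, for every pair of probability vectors w, v ∈ S^K with strictly positive entries, the penalty c·∑_{k=1}^K w_k f(v_k/w_k) equals the Kullback–Leibler divergence ∑_{k=1}^K w_k log(w_k/v_k). -/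
/-- **Theorem 3.1, characterization of the KL divergence.**
If the penalized model-selection criterion with penalty `c·f(w^op_k)` agrees with
optimism-penalized model selection for all optimism vectors `op` and all score vectors `S`,
then `c·f(x) = −log x` on `(0,∞)`; in particular the f-divergence `c·∑ w_k f(v_k/w_k)`
coincides with the Kullback–Leibler divergence `∑ w_k log(w_k/v_k)`. -/
theorem boundary_condition_forces_KL
    (K : ℕ) (hK : 3 ≤ K) (c : ℝ) (hc : 0 < c) (f : ℝ → ℝ)
    (hconv : ConvexOn ℝ (Set.Ioi (0 : ℝ)) f)
    (hanal : AnalyticOnNhd ℝ f (Set.Ioi (0 : ℝ)))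
    (hf1 : f 1 = 0)
    (hargmin : ∀ op S : Fin K → ℝ,
      {k : Fin K | ∀ j : Fin K,
          c * f (Real.exp (-op k) / ∑ l : Fin K, Real.exp (-op l)) + S k ≤
          c * f (Real.exp (-op j) / ∑ l : Fin K, Real.exp (-op l)) + S j} =
      {k : Fin K | ∀ j : Fin K, op k + S k ≤ op j + S j}) :
    (∀ x : ℝ, 0 < x → c * f x = -Real.log x) ∧
    (∀ w v : Fin K → ℝ, (∀ k, 0 < w k) → (∑ k, w k = 1) →
      (∀ k, 0 < v k) → (∑ k, v k = 1) →
      c * ∑ k, w k * f (v k / w k) = ∑ k, w k * Real.log (w k / v k)) := by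
  have key : ∀ x y : ℝ, 0 < x → 0 < y → x + y < 1 →
      c * f x + Real.log x = c * f y + Real.log y := by
    intro x y hx hy hxy
    obtain ⟨n, rfl⟩ : ∃ n, K = n + 3 := ⟨K - 3, by omega⟩
    have hn : (0 : ℝ) < (n : ℝ) + 1 := by positivity
    let w : Fin (n + 3) → ℝ := Fin.cons x (Fin.cons y (fun _ => (1 - x - y) / ((n : ℝ) + 1)))
    have hw0 : w 0 = x := rfl
    have hw1 : w 1 = y := rfl
    have hwpos : ∀ k, 0 < w k := by
      intro k
      refine Fin.cases hx (fun k => ?_) k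
      refine Fin.cases hy (fun k => ?_) k
      exact div_pos (by linarith) hn
    have hsum : ∑ k, w k = 1 := by
      rw [Fin.sum_univ_succ, Fin.sum_univ_succ]
      simp only [w, Fin.cons_zero, Fin.cons_succ, Finset.sum_const, Finset.card_univ,
        Fintype.card_fin, nsmul_eq_mul]
      push_cast
      field_simp
      ring
    have hexp : ∀ k, Real.exp (-(-Real.log (w k))) = w k := fun k => by
      rw [neg_neg, Real.exp_log (hwpos k)]
    have h := hargmin (fun k => -Real.log (w k)) (fun k => Real.log (w k))
    simp only [hexp, hsum, div_one] at h
    have hall : ∀ k : Fin (n + 3), ∀ j : Fin (n + 3),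
        c * f (w k) + Real.log (w k) ≤ c * f (w j) + Real.log (w j) := by
      intro k
      have hk : k ∈ {k : Fin (n + 3) | ∀ j : Fin (n + 3),
          -Real.log (w k) + Real.log (w k) ≤ -Real.log (w j) + Real.log (w j)} := by
        intro j
        simp
      rw [← h] at hk
      exact hk
    exact le_antisymm (hall 0 1) (hall 1 0)
  have hg : AnalyticOnNhd ℝ (fun x => c * f x + Real.log x) (Set.Ioi (0 : ℝ)) := by
    intro x hx
    exact (analyticAt_const.mul (hanal x hx)).add (analyticAt_log hx)
  have hconst : ∀ x : ℝ, 0 < x → x < 1 →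
      c * f x + Real.log x = c * f (1 / 2) + Real.log (1 / 2) := by
    intro x hx hx1
    have hz : 0 < min ((1 - x) / 2) (1 / 4) := lt_min (by linarith) (by norm_num)
    have h1 := min_le_left ((1 - x) / 2) (1 / 4)
    have h2 := min_le_right ((1 - x) / 2) (1 / 4)
    rw [key x _ hx hz (by linarith), key (1 / 2) _ (by norm_num) hz (by linarith)]
  have heq : Set.EqOn (fun x => c * f x + Real.log x)
      (fun _ => c * f (1 / 2) + Real.log (1 / 2)) (Set.Ioi (0 : ℝ)) := by
    refine hg.eqOn_of_preconnected_of_eventuallyEq analyticOnNhd_const isPreconnected_Ioi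
      (z₀ := 1 / 2) (by norm_num) ?_
    filter_upwards [Ioo_mem_nhds (show (0 : ℝ) < 1 / 2 by norm_num)
      (show (1 / 2 : ℝ) < 1 by norm_num)] with x hx
    exact hconst x hx.1 hx.2
  have main : ∀ x : ℝ, 0 < x → c * f x = -Real.log x := by
    intro x hx
    have hx' := heq (Set.mem_Ioi.2 hx)
    have h1 := heq (Set.mem_Ioi.2 one_pos)
    simp only [hf1, mul_zero, Real.log_one, add_zero] at h1
    simp only [← h1] at hx'
    linarith
  refine ⟨main, fun w v hw _ hv _ => ?_⟩
  rw [Finset.mul_sum]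
  refine Finset.sum_congr rfl fun k _ => ?_
  rw [mul_left_comm, main _ (div_pos (hv k) (hw k)), ← Real.log_inv, inv_div]
end

section
/- Let ỹ_1, …, ỹ_n be i.i.d. with law Q, assume E_Q[−log p_k(y)] is finite for each k, and assume the quantity φ_term = log( (1/K) ∑_{k=1}^K E[ exp( ∑_{i=1}^n log p_k(ỹ_i) − n·E_Q[log p_k(y)] ) ] ) is finite. Then for any δ ∈ (0, 1], with probability at least 1 − δ, simultaneously for all w^p ∈ S^K: n·∑_{k=1}^K w^p_k E_Q[−log p_k(y)] ≤ −∑_{i=1}^n ∑_{k=1}^K w^p_k log p_k(ỹ_i) + ∑_{k=1}^K w^p_k log w^p_k + log K − log δ + φ_term. -/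
open MeasureTheory

lemma gibbs_aux {K : ℕ} (hK : 1 ≤ K) (w g : Fin K → ℝ) (hw : ∀ k, 0 ≤ w k)
    (hw1 : ∑ k, w k = 1) :
    ∑ k, w k * g k - ∑ k, w k * Real.log (w k) ≤ Real.log (∑ k, Real.exp (g k)) := by
  haveI : Nonempty (Fin K) := ⟨⟨0, hK⟩⟩
  set F := ∑ k, Real.exp (g k) with hF
  have hFpos : 0 < F := Finset.sum_pos (fun k _ => Real.exp_pos _) Finset.univ_nonempty
  have key : ∀ k, w k * g k - w k * Real.log (w k) - w k * Real.log F
      ≤ Real.exp (g k) / F - w k := by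
    intro k
    have he := Real.exp_pos (g k)
    rcases (hw k).eq_or_lt with h | h
    · rw [← h]; simp; positivity
    · have h1 := Real.log_le_sub_one_of_pos (x := Real.exp (g k) / (F * w k)) (by positivity)
      rw [Real.log_div he.ne' (by positivity), Real.log_mul hFpos.ne' h.ne', Real.log_exp] at h1
      have h2 := mul_le_mul_of_nonneg_left h1 h.le
      have h3 : w k * (Real.exp (g k) / (F * w k) - 1) = Real.exp (g k) / F - w k := by
        field_simp
      rw [h3] at h2
      linarith
  have hs := Finset.sum_le_sum (fun k (_ : k ∈ Finset.univ) => key k)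
  simp only [Finset.sum_sub_distrib, ← Finset.sum_mul, ← Finset.sum_div] at hs
  rw [hw1, ← hF, div_self hFpos.ne'] at hs
  linarith

/-- **general PAC bound with uniform prior, Theorem C.5.**
Without any tail assumption, for any `δ ∈ (0,1]`, with probability at least `1 − δ` over
an i.i.d. sample `ỹ₁, …, ỹₙ ~ Q`, simultaneously for all posterior probability vectors
`w^p`: `n·∑ₖ w^pₖ E_Q[−log pₖ] ≤ −∑ᵢ∑ₖ w^pₖ log pₖ(ỹᵢ) + ∑ₖ w^pₖ log w^pₖ + log K − log δ + φ_term`,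
where `φ_term = log((1/K)·∑ₖ E[exp(∑ᵢ log pₖ(ỹᵢ) − n·E_Q[log pₖ])])`. -/
theorem pac_bound_general
    {Y : Type*} [MeasurableSpace Y] (Q : Measure Y) [IsProbabilityMeasure Q]
    (K : ℕ) (hK : 1 ≤ K) (p : Fin K → Y → ℝ)
    (hmeas : ∀ k, Measurable (p k)) (hpos : ∀ k y, 0 < p k y)
    (hint : ∀ k, Integrable (fun y => Real.log (p k y)) Q)
    (n : ℕ) (hn : 1 ≤ n)
    (hφint : ∀ k, Integrable
      (fun ys : Fin n → Y => Real.exp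
        ((∑ i : Fin n, Real.log (p k (ys i))) - (n : ℝ) * ∫ y, Real.log (p k y) ∂Q))
      (Measure.pi fun _ : Fin n => Q))
    (δ : ℝ) (hδ0 : 0 < δ) (hδ1 : δ ≤ 1) :
    ENNReal.ofReal (1 - δ) ≤
      (Measure.pi fun _ : Fin n => Q)
        {ys : Fin n → Y | ∀ wp : Fin K → ℝ, (∀ k, 0 ≤ wp k) → (∑ k, wp k = 1) →
          (n : ℝ) * ∑ k, wp k * (∫ y, -Real.log (p k y) ∂Q) ≤
            -(∑ i : Fin n, ∑ k, wp k * Real.log (p k (ys i)))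
              + ∑ k, wp k * Real.log (wp k)
              + Real.log K - Real.log δ
              + Real.log ((1 / (K : ℝ)) * ∑ k, ∫ ys : Fin n → Y,
                  Real.exp ((∑ i : Fin n, Real.log (p k (ys i)))
                    - (n : ℝ) * ∫ y, Real.log (p k y) ∂Q)
                  ∂(Measure.pi fun _ : Fin n => Q))} := by
  haveI : Nonempty (Fin K) := ⟨⟨0, hK⟩⟩
  set μ := Measure.pi fun _ : Fin n => Q with hμ
  set G : Fin K → (Fin n → Y) → ℝ := fun k ys =>
    (∑ i : Fin n, Real.log (p k (ys i))) - (n : ℝ) * ∫ y, Real.log (p k y) ∂Q with hG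
  set M : ℝ := ∑ k, ∫ ys, Real.exp (G k ys) ∂μ with hM
  have hMpos : 0 < M :=
    Finset.sum_pos (fun k _ => integral_exp_pos (hφint k)) Finset.univ_nonempty
  have hKpos : (0 : ℝ) < K := by exact_mod_cast hK
  have hMF : ∫ ys, ∑ k, Real.exp (G k ys) ∂μ = M :=
    integral_finsetSum _ (fun k _ => hφint k)
  have hFint : Integrable (fun ys => ∑ k, Real.exp (G k ys)) μ :=
    integrable_finsetSum _ (fun k _ => hφint k)
  have hmark := mul_meas_ge_le_integral_of_nonneg (μ := μ)
    (f := fun ys => ∑ k, Real.exp (G k ys))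
    (Filter.Eventually.of_forall fun ys => Finset.sum_nonneg fun k _ => (Real.exp_pos _).le)
    hFint (M / δ)
  rw [hMF] at hmark
  set B := {ys | M / δ ≤ ∑ k, Real.exp (G k ys)} with hB
  have hBδ : μ.real B ≤ δ := by
    have : M / δ * μ.real B = M * (μ.real B / δ) := by ring
    rw [this] at hmark
    have h2 : μ.real B / δ ≤ 1 := by
      by_contra! hc
      nlinarith
    rwa [div_le_one hδ0] at h2
  have hBc : 1 - δ ≤ μ.real Bᶜ := by
    have h1 : μ.real (B ∪ Bᶜ) ≤ μ.real B + μ.real Bᶜ := measureReal_union_le _ _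
    rw [Set.union_compl_self, probReal_univ] at h1
    linarith
  calc ENNReal.ofReal (1 - δ) ≤ ENNReal.ofReal (μ.real Bᶜ) := ENNReal.ofReal_le_ofReal hBc
    _ = μ Bᶜ := ofReal_measureReal
    _ ≤ _ := measure_mono ?_
  intro ys hys wp hw hw1
  have hlt : ∑ k, Real.exp (G k ys) < M / δ := not_le.mp hys
  have hg := gibbs_aux hK wp (fun k => G k ys) hw hw1
  have hFpos : 0 < ∑ k, Real.exp (G k ys) :=
    Finset.sum_pos (fun k _ => Real.exp_pos _) Finset.univ_nonempty
  have hl := Real.log_le_log hFpos hlt.le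
  rw [Real.log_div hMpos.ne' hδ0.ne'] at hl
  have hlog : Real.log (1 / (K : ℝ) * M) = Real.log M - Real.log K := by
    rw [Real.log_mul (by positivity) hMpos.ne', one_div, Real.log_inv]; ring
  have hsum : ∑ k, wp k * G k ys = (∑ i : Fin n, ∑ k, wp k * Real.log (p k (ys i)))
      + (n : ℝ) * ∑ k, wp k * (∫ y, -Real.log (p k y) ∂Q) := by
    rw [Finset.sum_comm, Finset.mul_sum, ← Finset.sum_add_distrib]
    refine Finset.sum_congr rfl fun k _ => ?_
    rw [integral_neg, ← Finset.mul_sum]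
    simp only [hG]
    ring
  rw [hlog]
  linarith
end

section
/- Let n, K ≥ 1 and let p_{k,i} > 0 and q_{k,i} > 0 (for 1 ≤ k ≤ K, 1 ≤ i ≤ n) be real numbers (interpreted as in-sample density values p_k(y_i) and out-of-sample density values p_k(ỹ_i)). Set a_k = −∑_{i=1}^n log p_{k,i}, b_k = −∑_{i=1}^n log q_{k,i}, and op_k = b_k − a_k, and let w^op_k = exp(−op_k)/∑_j exp(−op_j). Assume a_k > 0 for every k and let m = min_k b_k/a_k with m > 1. Then for every w ∈ S^K: (m − 1)·J_IN(w) ≤ (m − 1)·∑_{i=1}^n log ∑_{k=1}^K w_k p_{k,i} − ∑_{k=1}^K w_k log w_k + ∑_{k=1}^K w_k log(w_k / w^op_k) − log ∑_{k=1}^K exp(−op_k), where J_IN(w) = −∑_{i=1}^n ∑_{k=1}^K w_k log p_{k,i} + ∑_{i=1}^n log ∑_{k=1}^K w_k p_{k,i}. -/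
/-- **key deterministic step in the proof of Theorem 3.4.**
With `aₖ = −∑ᵢ log pₖᵢ > 0`, `bₖ = −∑ᵢ log qₖᵢ`, `opₖ = bₖ − aₖ`,
`w^opₖ = exp(−opₖ)/∑ⱼ exp(−opⱼ)` and `m = minₖ bₖ/aₖ > 1`, for every probability
vector `w`: `(m−1)·J_IN(w) ≤ (m−1)·∑ᵢ log ∑ₖ wₖ pₖᵢ − ∑ₖ wₖ log wₖ + ∑ₖ wₖ log(wₖ/w^opₖ)
− log ∑ₖ exp(−opₖ)`, where `J_IN(w) = −∑ᵢ∑ₖ wₖ log pₖᵢ + ∑ᵢ log ∑ₖ wₖ pₖᵢ`. -/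
theorem jensen_gap_overfitting_inequality
    (n K : ℕ) (hn : 1 ≤ n) (hK : 1 ≤ K)
    (p q : Fin K → Fin n → ℝ) (hp : ∀ k i, 0 < p k i) (hq : ∀ k i, 0 < q k i)
    (a b : Fin K → ℝ)
    (ha_def : ∀ k, a k = -∑ i : Fin n, Real.log (p k i))
    (hb_def : ∀ k, b k = -∑ i : Fin n, Real.log (q k i))
    (op : Fin K → ℝ) (hop_def : ∀ k, op k = b k - a k)
    (ha_pos : ∀ k, 0 < a k)
    (m : ℝ) (hm_def : m = ⨅ k : Fin K, b k / a k) (hm : 1 < m)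
    (w : Fin K → ℝ) (hw : ∀ k, 0 ≤ w k) (hw1 : ∑ k, w k = 1) :
    (m - 1) * (-(∑ i : Fin n, ∑ k, w k * Real.log (p k i))
        + ∑ i : Fin n, Real.log (∑ k, w k * p k i)) ≤
      (m - 1) * (∑ i : Fin n, Real.log (∑ k, w k * p k i))
        - (∑ k, w k * Real.log (w k))
        + (∑ k, w k * Real.log (w k / (Real.exp (-op k) / ∑ j, Real.exp (-op j))))
        - Real.log (∑ k, Real.exp (-op k)) := by
  have hmk : ∀ k, (m - 1) * a k ≤ op k := by
    intro k
    have h1 : m ≤ b k / a k := by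
      rw [hm_def]
      exact ciInf_le (Set.finite_range _).bddBelow k
    rw [le_div_iff₀ (ha_pos k)] at h1
    rw [hop_def]
    linarith
  have hZ : 0 < ∑ j, Real.exp (-op j) := by
    haveI : Nonempty (Fin K) := ⟨⟨0, hK⟩⟩
    exact Finset.sum_pos (fun j _ => Real.exp_pos _) Finset.univ_nonempty
  have hterm : ∀ k, w k * Real.log (w k / (Real.exp (-op k) / ∑ j, Real.exp (-op j)))
      = w k * Real.log (w k) + w k * op k + w k * Real.log (∑ j, Real.exp (-op j)) := by
    intro k
    rcases (hw k).eq_or_lt with h | h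
    · simp [← h]
    · rw [Real.log_div h.ne' (div_pos (Real.exp_pos _) hZ).ne',
        Real.log_div (Real.exp_pos _).ne' hZ.ne', Real.log_exp]
      ring
  have hsum : ∑ k, w k * Real.log (w k / (Real.exp (-op k) / ∑ j, Real.exp (-op j)))
      = ∑ k, w k * Real.log (w k) + ∑ k, w k * op k + Real.log (∑ j, Real.exp (-op j)) := by
    rw [Finset.sum_congr rfl (fun k _ => hterm k), Finset.sum_add_distrib,
      Finset.sum_add_distrib, ← Finset.sum_mul, hw1, one_mul]
  have hJ : -(∑ i : Fin n, ∑ k, w k * Real.log (p k i)) = ∑ k, w k * a k := by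
    rw [Finset.sum_comm, ← Finset.sum_neg_distrib]
    refine Finset.sum_congr rfl (fun k _ => ?_)
    rw [ha_def, ← Finset.mul_sum]
    ring
  have hle : (m - 1) * ∑ k, w k * a k ≤ ∑ k, w k * op k := by
    rw [Finset.mul_sum]
    refine Finset.sum_le_sum (fun k _ => ?_)
    have := mul_le_mul_of_nonneg_left (hmk k) (hw k)
    linarith
  rw [hsum, hJ]
  linarith
end

section
/- Let n, K ≥ 1, let w ∈ S^K be a probability vector, and let p_{k,i} > 0 and q_{k,i} > 0 (for 1 ≤ k ≤ K, 1 ≤ i ≤ n) be positive real numbers. Then | ∑_{i=1}^n log ∑_{k=1}^K w_k p_{k,i} − ∑_{i=1}^n log ∑_{k=1}^K w_k q_{k,i} | ≤ ∑_{i=1}^n ∑_{k=1}^K | log p_{k,i} − log q_{k,i} |. -/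
lemma mix_pos {K : ℕ} (w : Fin K → ℝ) (hw : ∀ k, 0 ≤ w k) (hw1 : ∑ k, w k = 1)
    (p : Fin K → ℝ) (hp : ∀ k, 0 < p k) : 0 < ∑ k, w k * p k := by
  have h0 : ∀ k ∈ Finset.univ, 0 ≤ w k * p k := fun k _ => mul_nonneg (hw k) (hp k).le
  refine lt_of_le_of_ne (Finset.sum_nonneg h0) (fun h => ?_)
  have h2 := (Finset.sum_eq_zero_iff_of_nonneg h0).1 h.symm
  have h3 : ∑ k, w k = 0 := Finset.sum_eq_zero fun k hk =>
    (mul_eq_zero.1 (h2 k hk)).resolve_right (hp k).ne'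
  linarith

lemma mix_log_le {K : ℕ} (w : Fin K → ℝ) (hw : ∀ k, 0 ≤ w k) (hw1 : ∑ k, w k = 1)
    (p q : Fin K → ℝ) (hp : ∀ k, 0 < p k) (hq : ∀ k, 0 < q k) :
    Real.log (∑ k, w k * p k) - Real.log (∑ k, w k * q k) ≤
      ∑ k, |Real.log (p k) - Real.log (q k)| := by
  set D := ∑ k, |Real.log (p k) - Real.log (q k)| with hD
  have hk : ∀ k, p k ≤ Real.exp D * q k := by
    intro k
    have h1 : |Real.log (p k) - Real.log (q k)| ≤ D :=
      Finset.single_le_sum (f := fun k => |Real.log (p k) - Real.log (q k)|)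
        (fun _ _ => abs_nonneg _) (Finset.mem_univ k)
    have h2 := le_abs_self (Real.log (p k) - Real.log (q k))
    calc p k = Real.exp (Real.log (p k)) := (Real.exp_log (hp k)).symm
      _ ≤ Real.exp (D + Real.log (q k)) := Real.exp_le_exp.2 (by linarith)
      _ = Real.exp D * q k := by rw [Real.exp_add, Real.exp_log (hq k)]
  have hP := mix_pos w hw hw1 p hp
  have hQ := mix_pos w hw hw1 q hq
  have hPQ : ∑ k, w k * p k ≤ Real.exp D * ∑ k, w k * q k := by
    rw [Finset.mul_sum]
    refine Finset.sum_le_sum fun k _ => ?_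
    have := mul_le_mul_of_nonneg_left (hk k) (hw k)
    linarith
  have h := Real.log_le_log hP hPQ
  rw [Real.log_mul (Real.exp_pos D).ne' hQ.ne', Real.log_exp] at h
  linarith

/-- **ℓ¹-Lipschitz property of the mixture log score.** For any
probability vector `w` and positive numbers `pₖᵢ`, `qₖᵢ`:
`|∑ᵢ log ∑ₖ wₖ pₖᵢ − ∑ᵢ log ∑ₖ wₖ qₖᵢ| ≤ ∑ᵢ∑ₖ |log pₖᵢ − log qₖᵢ|`. -/
theorem mixture_log_score_lipschitz
    (n K : ℕ) (hn : 1 ≤ n) (hK : 1 ≤ K)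
    (w : Fin K → ℝ) (hw : ∀ k, 0 ≤ w k) (hw1 : ∑ k, w k = 1)
    (p q : Fin K → Fin n → ℝ) (hp : ∀ k i, 0 < p k i) (hq : ∀ k i, 0 < q k i) :
    |(∑ i : Fin n, Real.log (∑ k, w k * p k i))
        - ∑ i : Fin n, Real.log (∑ k, w k * q k i)| ≤
      ∑ i : Fin n, ∑ k, |Real.log (p k i) - Real.log (q k i)| := by
  rw [← Finset.sum_sub_distrib]
  refine (Finset.abs_sum_le_sum_abs _ _).trans (Finset.sum_le_sum fun i _ => ?_)
  have h1 := mix_log_le w hw hw1 (fun k => p k i) (fun k => q k i)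
    (fun k => hp k i) (fun k => hq k i)
  have h2 := mix_log_le w hw hw1 (fun k => q k i) (fun k => p k i)
    (fun k => hq k i) (fun k => hp k i)
  simp only [abs_sub_comm (Real.log (q _ i))] at h2
  exact abs_le.2 ⟨by linarith, h1⟩
end
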